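/- arXiv:1804.08252 — 2 statements merged into one kernel-verified Lean document; each statement's English description precedes it below -/
import Mathlib

section
/- Let Π_1 = (M^1, P^1, Q^1) and Π_2 = (M^2, P^2, Q^2) be pairwise disjoint distance-d partition systems for Z_n (each with a fixed choice function), and suppose hd(M^1, M^2) ≥ d−1, i.e., every permutation occurring in a set of the list M^1 has Hamming distance at least d−1 from every permutation occurring in a set of the list M^2. Then hd(ext(Π_1)) ≥ d, hd(ext(Π_2)) ≥ d, and hd(ext(Π_1), ext(Π_2)) ≥ d−1. -/
/-- Extend a permutation of `Fin n` to a permutation of `Fin (n+1)` fixing the new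
last element `n`. -/
def extFix {n : ℕ} (σ : Equiv.Perm (Fin n)) : Equiv.Perm (Fin (n + 1)) :=
  σ.viaFintypeEmbedding ⟨Fin.castSucc, Fin.castSucc_injective n⟩

/-- The extension `ext_k(σ)` of a permutation `σ` of `Z_n` by position `k`:
it sends `k ↦ n`, `n ↦ σ k`, and `j ↦ σ j` for every other `j < n`. -/
def extPerm {n : ℕ} (σ : Equiv.Perm (Fin n)) (k : Fin n) : Equiv.Perm (Fin (n + 1)) :=
  Equiv.swap (Fin.castSucc (σ k)) (Fin.last n) * extFix σ

/-- A distance-`d` partition system for `Z_n`, together with a fixed choice function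
designating a covering position for each covered permutation. -/
structure PartitionSystem (n s d : ℕ) where
  /-- the list `M_1, …, M_{s+1}` of pairwise disjoint sets of permutations -/
  M : Fin (s + 1) → Finset (Equiv.Perm (Fin n))
  /-- the ordered partition of positions `P_1, …, P_s` -/
  P : Fin s → Finset (Fin n)
  /-- the ordered partition of symbols `Q_1, …, Q_s` -/
  Q : Fin s → Finset (Fin n)
  M_disjoint : ∀ i j, i ≠ j → Disjoint (M i) (M j)
  P_disjoint : ∀ i j, i ≠ j → Disjoint (P i) (P j)
  P_cover : ∀ x : Fin n, ∃ i, x ∈ P i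
  Q_disjoint : ∀ i j, i ≠ j → Disjoint (Q i) (Q j)
  Q_cover : ∀ x : Fin n, ∃ i, x ∈ Q i
  /-- Property (I): `hd(M_i) ≥ d` -/
  hd_intra : ∀ i, ∀ σ ∈ M i, ∀ τ ∈ M i, σ ≠ τ → d ≤ hammingDist ⇑σ ⇑τ
  /-- Property (II): `hd(M_i, M_j) ≥ d − 1` for `i ≠ j` -/
  hd_inter : ∀ i j, i ≠ j → ∀ σ ∈ M i, ∀ τ ∈ M j, d - 1 ≤ hammingDist ⇑σ ⇑τ
  /-- the choice function designating a covering position for each covered permutation -/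
  choice : Fin s → Equiv.Perm (Fin n) → Fin n
  choice_spec : ∀ i σ, (∃ p ∈ P i, σ p ∈ Q i) →
    choice i σ ∈ P i ∧ σ (choice i σ) ∈ Q i

/-- The extended array `ext(Π)`: all `ext_{p_σ}(σ)` for covered `σ ∈ M_i` (`1 ≤ i ≤ s`),
together with the extensions of all `σ ∈ M_{s+1}` by the fixed point `n ↦ n`. -/
def extSet {n s d : ℕ} (Ps : PartitionSystem n s d) :
    Finset (Equiv.Perm (Fin (n + 1))) :=
  ((Finset.univ : Finset (Fin s)).biUnion fun i =>
    ((Ps.M i.castSucc).filter fun σ => ∃ p ∈ Ps.P i, σ p ∈ Ps.Q i).image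
      fun σ => extPerm σ (Ps.choice i σ))
  ∪ (Ps.M (Fin.last s)).image extFix

section HammingDist

variable {ι κ α β : Type*} [Fintype ι] [Fintype κ] [DecidableEq α] [DecidableEq β]

theorem hammingDist_le_of_injective {f g : ι → α} {f' g' : κ → β} {e : ι → κ}
    (he : Function.Injective e) (h : ∀ x, f x ≠ g x → f' (e x) ≠ g' (e x)) :
    hammingDist f g ≤ hammingDist f' g' :=
  Finset.card_le_card_of_injOn e (fun x hx => by simpa using h x (by simpa using hx))
    he.injOn

theorem hammingDist_lt_of_injective {f g : ι → α} {f' g' : κ → β} {e : ι → κ}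
    (he : Function.Injective e) (h : ∀ x, f x ≠ g x → f' (e x) ≠ g' (e x))
    {y : κ} (hy : ∀ x, e x ≠ y) (hne : f' y ≠ g' y) :
    hammingDist f g < hammingDist f' g' := by
  classical
  rw [hammingDist, ← Finset.card_image_of_injective _ he]
  refine Finset.card_lt_card ((Finset.ssubset_iff_of_subset ?_).2 ⟨y, ?_, ?_⟩)
  · intro z hz
    obtain ⟨x, hx, rfl⟩ := Finset.mem_image.1 hz
    simpa using h x (by simpa using hx)
  · simpa using hne
  · simp [hy]

end HammingDist

section Extension

variable {n : ℕ} (σ τ : Equiv.Perm (Fin n)) (p q x : Fin n)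

@[simp]
theorem extFix_castSucc : extFix σ x.castSucc = (σ x).castSucc :=
  σ.viaFintypeEmbedding_apply_image ⟨Fin.castSucc, Fin.castSucc_injective n⟩ x

@[simp]
theorem extFix_last : extFix σ (Fin.last n) = Fin.last n :=
  σ.viaFintypeEmbedding_apply_notMem_range _ (by simp)

@[simp]
theorem extPerm_last : extPerm σ p (Fin.last n) = (σ p).castSucc := by
  simp [extPerm]

theorem extPerm_castSucc :
    extPerm σ p x.castSucc = if x = p then Fin.last n else (σ x).castSucc := by
  simp [extPerm, Equiv.swap_apply_def, Fin.castSucc_ne_last]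

theorem hammingDist_le_extFix : hammingDist σ τ ≤ hammingDist (extFix σ) (extFix τ) :=
  hammingDist_le_of_injective (Fin.castSucc_injective n) (by simp)

theorem hammingDist_lt_extFix_extPerm :
    hammingDist σ τ < hammingDist (extFix σ) (extPerm τ q) := by
  refine hammingDist_lt_of_injective (Fin.castSucc_injective n) (fun x hx => ?_)
    Fin.castSucc_ne_last (by simpa using (Fin.castSucc_ne_last _).symm)
  rw [extFix_castSucc, extPerm_castSucc]
  split_ifs
  · exact Fin.castSucc_ne_last _
  · simpa using hx

variable {σ τ p q} in
theorem extPerm_castSucc_ne (hpq : p ≠ q) {x : Fin n} (hx : σ x ≠ τ x) :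
    extPerm σ p x.castSucc ≠ extPerm τ q x.castSucc := by
  rw [extPerm_castSucc, extPerm_castSucc]
  split_ifs with h₁ h₂
  · exact absurd (h₁.symm.trans h₂) hpq
  · exact (Fin.castSucc_ne_last _).symm
  · exact Fin.castSucc_ne_last _
  · simpa using hx

theorem hammingDist_le_extPerm :
    hammingDist σ τ ≤ hammingDist (extPerm σ p) (extPerm τ q) := by
  rcases eq_or_ne p q with rfl | hpq
  · refine hammingDist_le_of_injective (e := fun x => if x = p then Fin.last n else x.castSucc)
      (fun x y hxy => ?_) (fun x hx => ?_)
    · dsimp only at hxy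
      split_ifs at hxy with h₁ h₂ h₂
      · exact h₁.trans h₂.symm
      · exact absurd hxy.symm (Fin.castSucc_ne_last y)
      · exact absurd hxy (Fin.castSucc_ne_last x)
      · exact Fin.castSucc_injective n hxy
    · split_ifs with h
      · subst h
        simpa using hx
      · simpa [extPerm_castSucc, h] using hx
  · exact hammingDist_le_of_injective (Fin.castSucc_injective n)
      (fun x hx => extPerm_castSucc_ne hpq hx)

variable {σ τ p q} in
theorem hammingDist_lt_extPerm (hpq : p ≠ q) (h : σ p ≠ τ q) :
    hammingDist σ τ < hammingDist (extPerm σ p) (extPerm τ q) :=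
  hammingDist_lt_of_injective (Fin.castSucc_injective n)
    (fun x hx => extPerm_castSucc_ne hpq hx) Fin.castSucc_ne_last (by simpa using h)

end Extension

theorem mem_extSet {n s d : ℕ} {Ps : PartitionSystem n s d} {σ' : Equiv.Perm (Fin (n + 1))} :
    σ' ∈ extSet Ps ↔
      (∃ i, ∃ σ ∈ Ps.M i.castSucc, (Ps.choice i σ ∈ Ps.P i ∧ σ (Ps.choice i σ) ∈ Ps.Q i) ∧
        extPerm σ (Ps.choice i σ) = σ') ∨
      ∃ σ ∈ Ps.M (Fin.last s), extFix σ = σ' := by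
  simp only [extSet, Finset.mem_union, Finset.mem_biUnion, Finset.mem_univ, true_and,
    Finset.mem_image, Finset.mem_filter, and_assoc]
  refine or_congr_left (exists_congr fun i => exists_congr fun σ => and_congr_right fun _ => ?_)
  rw [← and_assoc]
  exact and_congr_left fun _ => ⟨Ps.choice_spec i σ, fun h => ⟨_, h⟩⟩

theorem le_hammingDist_of_mem_extSet {n s d : ℕ} (Ps : PartitionSystem n s d)
    {σ' τ' : Equiv.Perm (Fin (n + 1))} (hσ' : σ' ∈ extSet Ps) (hτ' : τ' ∈ extSet Ps)
    (hne : σ' ≠ τ') : d ≤ hammingDist σ' τ' := by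
  rcases mem_extSet.1 hσ' with ⟨i, σ, hσ, ⟨hp, hσp⟩, rfl⟩ | ⟨σ, hσ, rfl⟩ <;>
    rcases mem_extSet.1 hτ' with ⟨j, τ, hτ, ⟨hq, hτq⟩, rfl⟩ | ⟨τ, hτ, rfl⟩
  · rcases eq_or_ne i j with rfl | hij
    · refine (Ps.hd_intra _ σ hσ τ hτ ?_).trans (hammingDist_le_extPerm _ _ _ _)
      rintro rfl
      exact hne rfl
    · have hpq := Finset.disjoint_iff_ne.1 (Ps.P_disjoint i j hij) _ hp _ hq
      have hval := Finset.disjoint_iff_ne.1 (Ps.Q_disjoint i j hij) _ hσp _ hτq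
      have hdist := Ps.hd_inter _ _ (by simpa using hij) σ hσ τ hτ
      have hlt := hammingDist_lt_extPerm hpq hval
      omega
  · have hdist := Ps.hd_inter _ _ (Fin.castSucc_ne_last i).symm τ hτ σ hσ
    have hlt := hammingDist_lt_extFix_extPerm τ σ (Ps.choice i σ)
    rw [hammingDist_comm]
    omega
  · have hdist := Ps.hd_inter _ _ (Fin.castSucc_ne_last j).symm σ hσ τ hτ
    have hlt := hammingDist_lt_extFix_extPerm σ τ (Ps.choice j τ)
    omega
  · refine (Ps.hd_intra _ σ hσ τ hτ ?_).trans (hammingDist_le_extFix _ _)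
    rintro rfl
    exact hne rfl

theorem le_hammingDist_of_mem_extSet_of_mem_extSet {n s₁ s₂ d₁ d₂ k : ℕ}
    (Ps₁ : PartitionSystem n s₁ d₁) (Ps₂ : PartitionSystem n s₂ d₂)
    (hcross : ∀ i j, ∀ σ ∈ Ps₁.M i, ∀ τ ∈ Ps₂.M j, k ≤ hammingDist ⇑σ ⇑τ)
    {σ' τ' : Equiv.Perm (Fin (n + 1))} (hσ' : σ' ∈ extSet Ps₁) (hτ' : τ' ∈ extSet Ps₂) :
    k ≤ hammingDist σ' τ' := by
  rcases mem_extSet.1 hσ' with ⟨i, σ, hσ, -, rfl⟩ | ⟨σ, hσ, rfl⟩ <;>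
    rcases mem_extSet.1 hτ' with ⟨j, τ, hτ, -, rfl⟩ | ⟨τ, hτ, rfl⟩ <;>
    refine (hcross _ _ σ hσ τ hτ).trans ?_
  · exact hammingDist_le_extPerm _ _ _ _
  · rw [hammingDist_comm, hammingDist_comm (extPerm _ _ : Fin (n + 1) → Fin (n + 1))]
    exact (hammingDist_lt_extFix_extPerm _ _ _).le
  · exact (hammingDist_lt_extFix_extPerm _ _ _).le
  · exact hammingDist_le_extFix _ _

/-- **Theorem.** For pairwise disjoint distance-`d` partition systems `Π₁, Π₂` for `Z_n`
with `hd(M¹, M²) ≥ d−1`, we have `hd(ext(Π₁)) ≥ d`, `hd(ext(Π₂)) ≥ d`, and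
`hd(ext(Π₁), ext(Π₂)) ≥ d−1`. -/
theorem iterative_partition_and_extension {n s₁ s₂ d : ℕ}
    (Ps₁ : PartitionSystem n s₁ d) (Ps₂ : PartitionSystem n s₂ d)
    (hdisj : ∀ i j, Disjoint (Ps₁.M i) (Ps₂.M j))
    (hcross : ∀ i j, ∀ σ ∈ Ps₁.M i, ∀ τ ∈ Ps₂.M j, d - 1 ≤ hammingDist ⇑σ ⇑τ) :
    (∀ σ' ∈ extSet Ps₁, ∀ τ' ∈ extSet Ps₁, σ' ≠ τ' → d ≤ hammingDist ⇑σ' ⇑τ') ∧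
    (∀ σ' ∈ extSet Ps₂, ∀ τ' ∈ extSet Ps₂, σ' ≠ τ' → d ≤ hammingDist ⇑σ' ⇑τ') ∧
    (∀ σ' ∈ extSet Ps₁, ∀ τ' ∈ extSet Ps₂, d - 1 ≤ hammingDist ⇑σ' ⇑τ') := by
  exact ⟨fun _ hσ' _ hτ' => le_hammingDist_of_mem_extSet Ps₁ hσ' hτ',
    fun _ hσ' _ hτ' => le_hammingDist_of_mem_extSet Ps₂ hσ' hτ',
    fun _ hσ' _ hτ' => le_hammingDist_of_mem_extSet_of_mem_extSet Ps₁ Ps₂ hcross hσ' hτ'⟩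
end

section
/- Let n ≥ 2 and m ≥ 2 be integers and let k be a positive integer such that there exist k mutually orthogonal Latin squares of order n and k mutually orthogonal Latin squares of order m. Then M(nm+1, nm) ≥ k·n·m, i.e., there exists a set of k·n·m permutations of Z_{nm+1} whose pairwise Hamming distance is at least nm. -/
/-- A Latin square of order `n`: every row and every column is a bijection of `Z_n`. -/
def IsLatinSquare {n : ℕ} (L : Fin n → Fin n → Fin n) : Prop :=
  (∀ i, Function.Bijective fun j => L i j) ∧ (∀ j, Function.Bijective fun i => L i j)

/-- Two Latin squares of order `n` are orthogonal if the map
`(i,j) ↦ (L(i,j), L'(i,j))` is injective. -/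
def IsOrthogonal {n : ℕ} (L L' : Fin n → Fin n → Fin n) : Prop :=
  Function.Injective fun p : Fin n × Fin n => (L p.1 p.2, L' p.1 p.2)

/-- The permutations whose graphs are the sets of cells of a Latin square holding a given symbol. -/
lemma IsLatinSquare.exists_symbolPerm {n : ℕ} {L : Fin n → Fin n → Fin n} (hL : IsLatinSquare L) :
    ∃ P : Fin n → Equiv.Perm (Fin n), ∀ a i, L i (P a i) = a := by
  choose f hf using fun a i => (hL.1 i).2 a
  have hinj : ∀ a, Function.Injective (f a) := fun a i i' h =>
    (hL.2 (f a i)).1 (show L i (f a i) = L i' (f a i) from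
      (hf a i).trans (by rw [h]; exact (hf a i').symm))
  exact ⟨fun a => Equiv.ofBijective (f a) (Finite.injective_iff_bijective.1 (hinj a)), hf⟩

lemma exists_injective_of_isOrthogonal {ι : Type*} {n : ℕ} (hn : 2 ≤ n)
    {L : ι → Fin n → Fin n → Fin n} (hL : ∀ s, IsLatinSquare (L s))
    (hL_orth : ∀ s t, s ≠ t → IsOrthogonal (L s) (L t)) :
    ∃ r : ι → Fin n, Function.Injective r := by
  let z : Fin n := ⟨0, by omega⟩
  let o : Fin n := ⟨1, by omega⟩
  choose r hr using fun s => ((hL s).1 o).2 (L s z z)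
  refine ⟨r, fun s t h => ?_⟩
  by_contra hst
  have hcell : (o, r s) = (z, z) :=
    hL_orth s t hst (Prod.ext (hr s) (by simpa only [h] using hr t))
  simpa [o, z] using congrArg Prod.fst hcell

/-- Extend a permutation by a new point `none`, which is inserted in front of the image of `x`. -/
def Equiv.Perm.extendAt {α : Type*} [DecidableEq α] (π : Equiv.Perm α) (x : α) :
    Equiv.Perm (Option α) :=
  (Equiv.swap none (some x)).trans (Equiv.optionCongr π)

/-- Two maps agree in at most one point. -/
def AgreeAtMostOnce {α β : Type*} (f g : α → β) : Prop :=
  ∀ x y, f x = g x → f y = g y → x = y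

section extendAt

variable {α : Type*} [DecidableEq α] (π ρ : Equiv.Perm α) (x y : α)

lemma Equiv.Perm.extendAt_none : π.extendAt x none = some (π x) := by
  simp [Equiv.Perm.extendAt]

lemma Equiv.Perm.extendAt_some (z : α) :
    π.extendAt x (some z) = if z = x then none else some (π z) := by
  by_cases h : z = x
  · simp [Equiv.Perm.extendAt, h]
  · simp [Equiv.Perm.extendAt, h, Equiv.swap_apply_of_ne_of_ne]

variable {π ρ x y}

lemma agreeAtMostOnce_extendAt_of_forall_ne (h : ∀ z, π z ≠ ρ z) :
    AgreeAtMostOnce (π.extendAt x) (ρ.extendAt y) := by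
  rintro (_ | u) (_ | v) hu hv <;>
    simp only [Equiv.Perm.extendAt_none, Equiv.Perm.extendAt_some] at hu hv <;> grind

lemma AgreeAtMostOnce.extendAt (h : AgreeAtMostOnce π ρ) (hxy : x ≠ y) (hne : π x ≠ ρ y) :
    AgreeAtMostOnce (π.extendAt x) (ρ.extendAt y) := by
  rintro (_ | u) (_ | v) hu hv <;>
    simp only [Equiv.Perm.extendAt_none, Equiv.Perm.extendAt_some] at hu hv <;>
    grind [AgreeAtMostOnce]

end extendAt

lemma AgreeAtMostOnce.permCongr {α β : Type*} {σ τ : Equiv.Perm α}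
    (h : AgreeAtMostOnce σ τ) (e : α ≃ β) :
    AgreeAtMostOnce (e.permCongr σ) (e.permCongr τ) := by
  intro x y hx hy
  simp only [Equiv.permCongr_apply, EmbeddingLike.apply_eq_iff_eq] at hx hy
  exact e.symm.injective (h _ _ hx hy)

lemma AgreeAtMostOnce.ne {α β : Type*} [Nontrivial α] {f g : α → β}
    (h : AgreeAtMostOnce f g) : f ≠ g := by
  rintro rfl
  obtain ⟨x, y, hxy⟩ := exists_pair_ne α
  exact hxy (h x y rfl rfl)

lemma AgreeAtMostOnce.card_le_hammingDist {α β : Type*} [Fintype α] [DecidableEq β] {f g : α → β}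
    (h : AgreeAtMostOnce f g) : Fintype.card α ≤ hammingDist f g + 1 := by
  have hle : (Finset.univ.filter fun x => f x = g x).card ≤ 1 :=
    Finset.card_le_one.2 fun x hx y hy => h x y (by simpa using hx) (by simpa using hy)
  have hsum := Finset.card_filter_add_card_filter_not (s := Finset.univ) fun x => f x = g x
  rw [Finset.card_univ] at hsum
  have hdist : hammingDist f g = (Finset.univ.filter fun x => ¬f x = g x).card := by
    simp only [hammingDist, ne_eq]
  omega

lemma IsOrthogonal.agreeAtMostOnce {n : ℕ} {L L' : Fin n → Fin n → Fin n}
    (h : IsOrthogonal L L') {π ρ : Fin n → Fin n} {a b : Fin n}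
    (hπ : ∀ i, L i (π i) = a) (hρ : ∀ i, L' i (ρ i) = b) : AgreeAtMostOnce π ρ := by
  intro x y hx hy
  have hcell : (x, π x) = (y, π y) := h (Prod.ext ((hπ x).trans (hπ y).symm) (by
    simpa only [hx, hy] using (hρ x).trans (hρ y).symm))
  exact congrArg Prod.fst hcell

/-- **Corollary.** Let `n, m ≥ 2` and let `k` be a positive integer such that there exist
`k` mutually orthogonal Latin squares of order `n` and `k` mutually orthogonal Latin
squares of order `m`. Then `M(nm+1, nm) ≥ k·n·m`: there exists a set of `k·n·m`
permutations of `Z_{nm+1}` whose pairwise Hamming distance is at least `nm`. -/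
theorem M_of_MOLS_product {n m k : ℕ} (hn : 2 ≤ n) (hm : 2 ≤ m) (hk : 0 < k)
    (L : Fin k → Fin n → Fin n → Fin n) (L' : Fin k → Fin m → Fin m → Fin m)
    (hL : ∀ s, IsLatinSquare (L s)) (hL' : ∀ s, IsLatinSquare (L' s))
    (hL_ne : ∀ s t, s ≠ t → L s ≠ L t) (hL'_ne : ∀ s t, s ≠ t → L' s ≠ L' t)
    (hL_orth : ∀ s t, s ≠ t → IsOrthogonal (L s) (L t))
    (hL'_orth : ∀ s t, s ≠ t → IsOrthogonal (L' s) (L' t)) :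
    ∃ S : Finset (Equiv.Perm (Fin (n * m + 1))), S.card = k * (n * m) ∧
      ∀ σ ∈ S, ∀ τ ∈ S, σ ≠ τ → n * m ≤ hammingDist ⇑σ ⇑τ := by
  obtain ⟨r, hr⟩ := exists_injective_of_isOrthogonal hn hL hL_orth
  obtain ⟨c, hc⟩ := exists_injective_of_isOrthogonal hm hL' hL'_orth
  choose P hP using fun s => (hL s).exists_symbolPerm
  choose Q hQ using fun s => (hL' s).exists_symbolPerm
  let R : Fin k × Fin n × Fin m → Equiv.Perm (Option (Fin n × Fin m)) := fun q =>
    Equiv.Perm.extendAt ((P q.1 q.2.1).prodCongr (Q q.1 q.2.2)) (r q.1, (Q q.1 q.2.2).symm (c q.1))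
  have hR : ∀ q q', q ≠ q' → AgreeAtMostOnce (R q) (R q') := by
    rintro ⟨s, a, b⟩ ⟨t, a', b'⟩ hne
    by_cases hst : s = t
    · subst hst
      refine agreeAtMostOnce_extendAt_of_forall_ne ?_
      rintro ⟨i, j⟩ hij
      obtain ⟨hi, hj⟩ : P s a i = P s a' i ∧ Q s b j = Q s b' j := by simpa using hij
      have ha : a = a' := by rw [← hP s a i, hi, hP]
      have hb : b = b' := by rw [← hQ s b j, hj, hQ]
      exact hne (by rw [ha, hb])
    · refine AgreeAtMostOnce.extendAt ?_ ?_ ?_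
      · rintro ⟨i, j⟩ ⟨i', j'⟩ h h'
        simp only [Equiv.prodCongr_apply, Prod.map_apply, Prod.mk.injEq] at h h'
        exact Prod.ext ((hL_orth s t hst).agreeAtMostOnce (hP s a) (hP t a') i i' h.1 h'.1)
          ((hL'_orth s t hst).agreeAtMostOnce (hQ s b) (hQ t b') j j' h.2 h'.2)
      · exact fun h => hst (hr (congrArg Prod.fst h))
      · exact fun h => hst (hc (by simpa using congrArg Prod.snd h))
  let e : Option (Fin n × Fin m) ≃ Fin (n * m + 1) := Fintype.equivFinOfCardEq (by simp)
  have hagree : ∀ q q', q ≠ q' → AgreeAtMostOnce (e.permCongr (R q)) (e.permCongr (R q')) :=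
    fun q q' h => (hR q q' h).permCongr e
  have : Nontrivial (Fin (n * m + 1)) := Fin.nontrivial_iff_two_le.2 (by nlinarith)
  have hinj : Function.Injective fun q => e.permCongr (R q) := fun q q' h => by
    by_contra hne
    exact (hagree q q' hne).ne (congrArg DFunLike.coe h)
  refine ⟨Finset.univ.map ⟨_, hinj⟩, by simp, ?_⟩
  intro σ hσ τ hτ hστ
  obtain ⟨q, -, rfl⟩ := Finset.mem_map.1 hσ
  obtain ⟨q', -, rfl⟩ := Finset.mem_map.1 hτ
  have hcard := (hagree q q' (fun h => hστ (by rw [h]))).card_le_hammingDist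
  rw [Fintype.card_fin] at hcard
  exact Nat.le_of_succ_le_succ hcard
end
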